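/- Let G be a connected finite simple graph on at least 2 vertices and H a finite simple graph with chromatic number χ(H) ≥ 2. Then the complete graph on (|V(G)|−1)·(χ(H)−1) vertices does not arrow (G,H): there exists a 2-colouring of the edges of the complete graph K_N with N = (|V(G)|−1)(χ(H)−1) with red and blue containing no red (not necessarily induced) subgraph isomorphic to G and no blue subgraph isomorphic to H. Consequently the Ramsey number satisfies R(G,H) ≥ (|V(G)|−1)(χ(H)−1) + 1. -/

import Mathlib

open SimpleGraph

/-- A graph `F` *arrows* the pair `(G, H)` (in the ordinary, not necessarily induced,
sense) if for every 2-colouring of the edges of `F` (encoded as the subgraph `R ≤ F`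
of red edges, the blue edges forming `F \ R`) there is a red subgraph isomorphic to
`G` or a blue subgraph isomorphic to `H`. -/
def Arrows {V α β : Type*} (F : SimpleGraph V) (G : SimpleGraph α)
    (H : SimpleGraph β) : Prop :=
  ∀ R : SimpleGraph V, R ≤ F →
    (∃ f : G →g R, Function.Injective f) ∨
    (∃ f : H →g F \ R, Function.Injective f)

/-- The Ramsey number `R(G, H)`: the least `N` such that the complete graph `K_N`
arrows `(G, H)`. -/
noncomputable def ramseyNumber {α β : Type*} (G : SimpleGraph α) (H : SimpleGraph β) : ℕ :=
  sInf {n : ℕ | Arrows (completeGraph (Fin n)) G H}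

/-- The two-colour finite Ramsey theorem: every sufficiently large set of vertices of a graph
contains a clique on `k` vertices or an independent set on `l` vertices. -/
theorem exists_isNClique_or_compl_isNClique {V : Type*} (R : SimpleGraph V) (k l : ℕ)
    (s : Finset V) (hs : (k + l).choose k ≤ s.card) :
    (∃ t ⊆ s, R.IsNClique k t) ∨ (∃ t ⊆ s, Rᶜ.IsNClique l t) := by
  classical
  induction k generalizing l s with
  | zero => exact Or.inl ⟨∅, by simp, by simp⟩
  | succ k ihk =>
    induction l generalizing s with
    | zero => exact Or.inr ⟨∅, by simp, by simp⟩
    | succ l ihl =>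
      obtain ⟨v, hv⟩ : s.Nonempty := by
        rw [← Finset.card_pos]
        exact (Nat.choose_pos (by omega)).trans_le hs
      set A := {w ∈ s | R.Adj v w}
      set B := {w ∈ s | ¬ R.Adj v w}
      have hAB : A.card + B.card = s.card := Finset.card_filter_add_card_filter_not _
      have hvB : v ∈ B := by simp [B, hv]
      have hB := Finset.card_erase_add_one hvB
      have hP : (k + 1 + (l + 1)).choose (k + 1) =
          (k + (l + 1)).choose k + (k + 1 + l).choose (k + 1) := by
        rw [show k + 1 + (l + 1) = (k + (l + 1)) + 1 by ring, Nat.choose_succ_succ,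
          show k + (l + 1) = k + 1 + l by ring]
      by_cases hA : (k + (l + 1)).choose k ≤ A.card
      · rcases ihk (l + 1) A hA with ⟨t, htA, ht⟩ | ⟨t, htA, ht⟩
        · refine Or.inl ⟨insert v t, ?_, ht.insert fun b hb => ?_⟩
          · exact Finset.insert_subset hv (htA.trans (Finset.filter_subset _ _))
          · exact (Finset.mem_filter.1 (htA hb)).2
        · exact Or.inr ⟨t, htA.trans (Finset.filter_subset _ _), ht⟩
      · have hBs : B.erase v ⊆ s := (Finset.erase_subset _ _).trans (Finset.filter_subset _ _)
        rcases ihl (B.erase v) (by omega) with ⟨t, htB, ht⟩ | ⟨t, htB, ht⟩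
        · exact Or.inl ⟨t, htB.trans hBs, ht⟩
        · refine Or.inr ⟨insert v t, Finset.insert_subset hv (htB.trans hBs),
            ht.insert fun b hb => ?_⟩
          have hb' := Finset.mem_erase.1 (htB hb)
          exact (SimpleGraph.compl_adj _ _ _).2 ⟨hb'.1.symm, (Finset.mem_filter.1 hb'.2).2⟩

/-- Every graph embeds into a clique on as many vertices. -/
theorem SimpleGraph.IsNClique.exists_injective_hom {V α : Type*} [Fintype α]
    {R : SimpleGraph V} {t : Finset V} (ht : R.IsNClique (Fintype.card α) t)
    (G : SimpleGraph α) : ∃ f : G →g R, Function.Injective f := by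
  let e : α ≃ t := Fintype.equivOfCardEq (by simp [ht.card_eq])
  have he : Function.Injective fun a => (e a : V) := Subtype.val_injective.comp e.injective
  exact ⟨⟨fun a => e a, fun h => ht.isClique (e _).2 (e _).2 (he.ne h.ne)⟩, he⟩

/-- Some complete graph arrows a given pair of finite graphs. -/
theorem exists_arrows_completeGraph {α β : Type*} [Fintype α] [Fintype β]
    (G : SimpleGraph α) (H : SimpleGraph β) :
    ∃ n : ℕ, Arrows (completeGraph (Fin n)) G H := by
  refine ⟨(Fintype.card α + Fintype.card β).choose (Fintype.card α), fun R _ => ?_⟩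
  rcases exists_isNClique_or_compl_isNClique R (Fintype.card α) (Fintype.card β) Finset.univ
    (by simp) with ⟨t, -, ht⟩ | ⟨t, -, ht⟩
  · exact Or.inl (ht.exists_injective_hom G)
  · have hcompl : completeGraph _ \ R = Rᶜ := top_sdiff
    exact Or.inr (hcompl ▸ ht.exists_injective_hom H)

/-- If the vertices split into parts smaller than a connected graph `G`, and `H` cannot be coloured
by the parts, then colouring the edges inside the parts red shows that `(G, H)` is not arrowed. -/
theorem not_arrows_completeGraph_of_embedding {V κ ι α β : Type*} [Fintype α] [Fintype κ]
    [Fintype ι] {G : SimpleGraph α} {H : SimpleGraph β} (hG : G.Connected)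
    (hι : Fintype.card ι < Fintype.card α) (hH : ¬ H.Colorable (Fintype.card κ))
    (e : V ↪ κ × ι) : ¬ Arrows (completeGraph V) G H := by
  intro h
  let R : SimpleGraph V :=
    { Adj := fun x y => x ≠ y ∧ (e x).1 = (e y).1
      symm := ⟨fun _ _ h => ⟨h.1.symm, h.2.symm⟩⟩
      loopless := ⟨fun _ h => h.1 rfl⟩ }
  rcases h R le_top with ⟨f, hf⟩ | ⟨f, -⟩
  · have hconst (x y : α) : (e (f x)).1 = (e (f y)).1 := by
      obtain ⟨p⟩ := hG.preconnected x y
      induction p with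
      | nil => rfl
      | cons hadj _ ih => exact (f.map_adj hadj).2.trans ih
    refine hι.not_ge (Fintype.card_le_of_injective (fun x => (e (f x)).2) fun x y hxy => ?_)
    exact hf (e.injective (Prod.ext (hconst x y) hxy))
  · refine hH (Coloring.colorable (Coloring.mk (fun x => (e (f x)).1) fun {x y} hxy heq => ?_))
    have hadj := (sdiff_adj _ _ _ _).1 (f.map_adj hxy)
    exact hadj.2 ⟨hadj.1, heq⟩

/-- **Theorem (Chvátal–Harary lower bound).**
If `G` is connected on at least two vertices and `H` has chromatic number `χ ≥ 2`,
then the complete graph on `(|V(G)| - 1)(χ - 1)` vertices does not arrow `(G, H)`,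
and consequently `R(G, H) ≥ (|V(G)| - 1)(χ - 1) + 1`. -/
theorem ramsey_lower_bound_chvatal_harary {γ δ : Type*} [Fintype γ] [Fintype δ]
    (G : SimpleGraph γ) (H : SimpleGraph δ) (χ : ℕ)
    (hG : G.Connected) (hcard : 2 ≤ Fintype.card γ)
    (hχ : H.chromaticNumber = χ) (hχ2 : 2 ≤ χ) :
    ¬ Arrows (completeGraph (Fin ((Fintype.card γ - 1) * (χ - 1)))) G H ∧
    (Fintype.card γ - 1) * (χ - 1) + 1 ≤ ramseyNumber G H := by
  have key (n : ℕ) (hn : n ≤ (Fintype.card γ - 1) * (χ - 1)) :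
      ¬ Arrows (completeGraph (Fin n)) G H := by
    refine not_arrows_completeGraph_of_embedding (κ := Fin (χ - 1))
      (ι := Fin (Fintype.card γ - 1)) hG (by rw [Fintype.card_fin]; omega) (fun hcol => ?_)
      ((Fin.castLEEmb (hn.trans_eq (mul_comm _ _))).trans finProdFinEquiv.symm.toEmbedding)
    have hle := hcol.chromaticNumber_le
    rw [hχ, Fintype.card_fin, Nat.cast_le] at hle
    omega
  refine ⟨key _ le_rfl, ?_⟩
  by_contra! hlt
  exact key _ (Nat.lt_succ_iff.1 hlt) (Nat.sInf_mem (exists_arrows_completeGraph G H))
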